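/- arXiv:1111.5588 — 8 statements merged into one kernel-verified Lean document; each statement's English description precedes it below -/
import Mathlib

section
/- For all real numbers γ* > 0 and d_* > 0 there exists h_* > 0 such that for every convex polygon Ω of diameter 1 satisfying G1 (γ < γ*) and G2 (|v_i − v_j| > d_* for all i ≠ j) and for every point x ∈ Ω, the closed ball B(x, h_*) does not intersect any three edges of Ω, nor any two non-adjacent edges of Ω. -/
open EuclideanGeometry Metric Real

noncomputable section

abbrev E2 := EuclideanSpace ℝ (Fin 2)

structure ConvexPolygon (n : ℕ) [NeZero n] where
  v : Fin n → E2
  hn : 3 ≤ n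
  extreme : ∀ i, v i ∈ Set.extremePoints ℝ (convexHull ℝ (Set.range v))
  boundary : frontier (convexHull ℝ (Set.range v)) = ⋃ i, segment ℝ (v i) (v (i + 1))

namespace ConvexPolygon

variable {n : ℕ} [NeZero n] (P : ConvexPolygon n)

def region : Set E2 := convexHull ℝ (Set.range P.v)

def edge (i : Fin n) : Set E2 := segment ℝ (P.v i) (P.v (i + 1))

def inradius : ℝ := sSup {r : ℝ | ∃ c : E2, Metric.closedBall c r ⊆ P.region}

def G1 (γs : ℝ) : Prop := Metric.diam P.region / P.inradius < γs

def G2 (ds : ℝ) : Prop := ∀ i j : Fin n, i ≠ j → ds < dist (P.v i) (P.v j)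

def interiorAngle (i : Fin n) : ℝ := ∠ (P.v (i - 1)) (P.v i) (P.v (i + 1))

def angleAt (i : Fin n) (x : E2) : ℝ := ∠ (P.v i) x (P.v (i + 1))

def r (i : Fin n) (x : E2) : ℝ := dist x (P.v i)

def t (i : Fin n) (x : E2) : ℝ := Real.tan (P.angleAt i x / 2)

def w (i : Fin n) (x : E2) : ℝ := (P.t (i - 1) x + P.t i x) / P.r i x

def lambda (i : Fin n) (x : E2) : ℝ := P.w i x / ∑ j, P.w j x

def nonadjacent (i j : Fin n) : Prop := i ≠ j ∧ i ≠ j + 1 ∧ j ≠ i + 1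

def SepProp (h : ℝ) : Prop :=
  ∀ x ∈ P.region,
    (∀ i j k : Fin n, i ≠ j → j ≠ k → i ≠ k →
      ¬((Metric.closedBall x h ∩ P.edge i).Nonempty ∧
        (Metric.closedBall x h ∩ P.edge j).Nonempty ∧
        (Metric.closedBall x h ∩ P.edge k).Nonempty)) ∧
    (∀ i j : Fin n, nonadjacent i j →
      ¬((Metric.closedBall x h ∩ P.edge i).Nonempty ∧
        (Metric.closedBall x h ∩ P.edge j).Nonempty))

end ConvexPolygon

def cr (u w : E2) : ℝ := u 0 * w 1 - u 1 * w 0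

lemma abs_cr_le (u w : E2) : |cr u w| ≤ ‖u‖ * ‖w‖ := by
  apply abs_le_of_sq_le_sq
  · rw [mul_pow, EuclideanSpace.norm_sq_eq, EuclideanSpace.norm_sq_eq]
    simp only [Fin.sum_univ_two, Real.norm_eq_abs, sq_abs, cr]
    nlinarith [sq_nonneg (u 0 * w 0 + u 1 * w 1)]
  · positivity

lemma bary (a b c z : E2) : cr (b - a) (c - a) • z =
    cr (b - z) (c - z) • a + cr (c - z) (a - z) • b + cr (b - a) (z - a) • c := by
  ext i
  fin_cases i <;> simp [cr] <;> ring

lemma bary_sum (a b c z : E2) : cr (b - a) (c - a) =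
    cr (b - z) (c - z) + cr (c - z) (a - z) + cr (b - a) (z - a) := by
  simp [cr]; ring

lemma bary_f (f : E2 →L[ℝ] ℝ) (M : ℝ) (a b c z : E2) (ha : f a = M) (hb : f b = M) :
    cr (b - a) (c - a) * (M - f z) = cr (b - a) (z - a) * (M - f c) := by
  have h := congrArg f (bary a b c z)
  simp only [map_add, map_smul, smul_eq_mul, ha, hb] at h
  have h2 := bary_sum a b c z
  linear_combination M * h2 - h

/-- the area bound -/
lemma area_bound (K : Set E2) (f : E2 →L[ℝ] ℝ) (M : ℝ) (hK : ∀ x ∈ K, f x ≤ M)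
    (a b c : E2) (r : ℝ) (hr : 0 < r) (hc : closedBall c r ⊆ K) (ha : f a = M) (hb : f b = M)
    (hfc : f c < M) (hab : a ≠ b) (hD : 0 ≤ cr (b - a) (c - a)) :
    r * dist a b ≤ cr (b - a) (c - a) := by
  have hL : 0 < ‖b - a‖ := norm_pos_iff.2 (sub_ne_zero.2 hab.symm)
  set L := ‖b - a‖ with hLdef
  have hL2 : L ^ 2 = (b 0 - a 0) ^ 2 + (b 1 - a 1) ^ 2 := by
    rw [hLdef, EuclideanSpace.norm_sq_eq]
    simp [Fin.sum_univ_two]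
  let nn : E2 := !₂[-(b 1 - a 1), (b 0 - a 0)]
  have hnn : ‖nn‖ = L := by
    rw [← sq_eq_sq₀ (norm_nonneg _) hL.le, hL2, EuclideanSpace.norm_sq_eq]
    simp [Fin.sum_univ_two, nn]; ring
  let z : E2 := c - (r / L) • nn
  have hz : z ∈ K := by
    apply hc
    rw [mem_closedBall, dist_eq_norm]
    simp only [z, sub_sub_cancel_left, norm_neg, norm_smul, hnn, Real.norm_eq_abs]
    rw [abs_of_pos (by positivity)]
    field_simp; rfl
  have h1 := bary_f f M a b c z ha hb
  have h2 : cr (b - a) (z - a) = cr (b - a) (c - a) - r * L := by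
    have : r * L = r / L * L ^ 2 := by field_simp
    rw [this, hL2]
    simp [cr, z, nn]; ring
  have h3 := hK z hz
  rw [dist_comm, dist_eq_norm, ← hLdef]
  rw [h2] at h1
  by_contra hcon
  push Not at hcon
  have h4 : 0 ≤ cr (b - a) (c - a) * (M - f z) := mul_nonneg hD (by linarith)
  nlinarith

lemma key0 (K : Set E2) (hKc : Convex ℝ K) (f : E2 →L[ℝ] ℝ) (M : ℝ) (hK : ∀ x ∈ K, f x ≤ M)
    (a b c : E2) (haK : a ∈ K) (hbK : b ∈ K) (r δ η : ℝ) (hr : 0 < r)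
    (hc : closedBall c r ⊆ K) (ha : f a = M) (hb : f b = M)
    (hfc : f c < M) (hab : a ≠ b) (hD : 0 ≤ cr (b - a) (c - a))
    (y z : E2) (hy : y ∈ segment ℝ a b) (hya : δ ≤ dist y a) (hyb : δ ≤ dist y b)
    (hyz : dist y z ≤ η) (hη : η < δ * r) (hca : dist c a ≤ 1) (hcb : dist c b ≤ 1)
    (hzK : z ∈ K) (hzi : z ∉ interior K) : z ∈ openSegment ℝ a b := by
  have hA := area_bound K f M hK a b c r hr hc ha hb hfc hab hD
  have hd : 0 < dist a b := dist_pos.2 hab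
  obtain ⟨s, t, hs, ht, hst, rfl⟩ := hy
  have hη0 : 0 ≤ η := dist_nonneg.trans hyz
  have hsd : δ ≤ s * dist a b := by
    have : s • a + t • b - b = s • (a - b) := by
      rw [← eq_sub_iff_add_eq'] at hst; subst hst; module
    rwa [dist_eq_norm, this, norm_smul, Real.norm_eq_abs, abs_of_nonneg hs,
      ← dist_eq_norm] at hyb
  have htd : δ ≤ t * dist a b := by
    have : s • a + t • b - a = t • (b - a) := by
      rw [← eq_sub_iff_add_eq] at hst; subst hst; module
    rwa [dist_eq_norm, this, norm_smul, Real.norm_eq_abs, abs_of_nonneg ht,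
      ← dist_eq_norm, dist_comm b a] at hya
  set y := s • a + t • b with hydef
  set D := cr (b - a) (c - a) with hDdef
  have hDpos : 0 < D := lt_of_lt_of_le (by positivity) hA
  have hyz' : ‖y - z‖ ≤ η := by rwa [← dist_eq_norm]
  have hα : 0 < cr (b - z) (c - z) := by
    have e : cr (b - z) (c - z) = s * D + cr (y - z) (c - b) := by
      have : s = 1 - t := by linarith
      rw [hydef, hDdef, this]; simp [cr]; ring
    have h1 := abs_cr_le (y - z) (c - b)
    rw [dist_eq_norm] at hcb
    have h2 : ‖y - z‖ * ‖c - b‖ ≤ η * 1 := by gcongr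
    have h3 := (abs_le.1 (h1.trans h2)).1
    nlinarith [mul_le_mul_of_nonneg_left hA hs, mul_le_mul_of_nonneg_right hsd hr.le]
  have hβ : 0 < cr (c - z) (a - z) := by
    have e : cr (c - z) (a - z) = t * D + cr (y - z) (a - c) := by
      have : s = 1 - t := by linarith
      rw [hydef, hDdef, this]; simp [cr]; ring
    have h1 := abs_cr_le (y - z) (a - c)
    rw [dist_comm, dist_eq_norm] at hca
    have h2 : ‖y - z‖ * ‖a - c‖ ≤ η * 1 := by gcongr
    have h3 := (abs_le.1 (h1.trans h2)).1
    nlinarith [mul_le_mul_of_nonneg_left hA ht, mul_le_mul_of_nonneg_right htd hr.le]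
  have hbary := bary a b c z
  have hsum := bary_sum a b c z
  have hf := bary_f f M a b c z ha hb
  rw [← hDdef] at hbary hsum hf
  set α := cr (b - z) (c - z)
  set β := cr (c - z) (a - z)
  set ζ := cr (b - a) (z - a)
  have hz : z = (α / D) • a + (β / D) • b + (ζ / D) • c := by
    have : z = D⁻¹ • (D • z) := by rw [smul_smul, inv_mul_cancel₀ hDpos.ne', one_smul]
    rw [this, hbary]; simp only [smul_add, smul_smul, div_eq_inv_mul]
  have hζ : 0 ≤ ζ := by
    have h3 := hK z hzK
    by_contra hcon
    push Not at hcon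
    have : 0 ≤ D * (M - f z) := mul_nonneg hDpos.le (by linarith)
    nlinarith
  rcases hζ.eq_or_lt with h0 | hpos
  · refine ⟨α / D, β / D, by positivity, by positivity, ?_, ?_⟩
    · rw [← add_div, div_eq_one_iff_eq hDpos.ne']; linarith
    · rw [hz, ← h0]; simp
  · exfalso
    apply hzi
    have hw : (α / (α + β)) • a + (β / (α + β)) • b ∈ K :=
      hKc haK hbK (by positivity) (by positivity) (by field_simp)
    have hci : c ∈ interior K :=
      interior_mono hc (ball_subset_interior_closedBall (mem_ball_self hr))
    have := hKc.combo_interior_self_mem_interior hci hw (a := ζ / D) (b := (α + β) / D)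
      (by positivity) (by positivity) (by rw [← add_div, div_eq_one_iff_eq hDpos.ne']; linarith)
    rw [hz]
    convert this using 1
    rw [smul_add, smul_smul, smul_smul, add_comm]
    congr 3 <;> field_simp

lemma key (K : Set E2) (hKc : Convex ℝ K) (f : E2 →L[ℝ] ℝ) (M : ℝ) (hK : ∀ x ∈ K, f x ≤ M)
    (a b c : E2) (haK : a ∈ K) (hbK : b ∈ K) (r δ η : ℝ) (hr : 0 < r)
    (hc : closedBall c r ⊆ K) (ha : f a = M) (hb : f b = M)
    (hfc : f c < M) (hab : a ≠ b)
    (y z : E2) (hy : y ∈ segment ℝ a b) (hya : δ ≤ dist y a) (hyb : δ ≤ dist y b)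
    (hyz : dist y z ≤ η) (hη : η < δ * r) (hca : dist c a ≤ 1) (hcb : dist c b ≤ 1)
    (hzK : z ∈ K) (hzi : z ∉ interior K) : z ∈ openSegment ℝ a b := by
  rcases le_total 0 (cr (b - a) (c - a)) with hD | hD
  · exact key0 K hKc f M hK a b c haK hbK r δ η hr hc ha hb hfc hab hD y z hy hya hyb hyz hη
      hca hcb hzK hzi
  · rw [openSegment_symm]
    rw [segment_symm] at hy
    refine key0 K hKc f M hK b a c hbK haK r δ η hr hc hb ha hfc hab.symm ?_ y z hy hyb hya hyz hη
      hcb hca hzK hzi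
    have : cr (a - b) (c - b) = - cr (b - a) (c - a) := by simp [cr]; ring
    linarith

lemma not_wbtw_of_extreme {K : Set E2} {a b p : E2} (ha : a ∈ K) (hb : b ∈ K)
    (hp : p ∈ Set.extremePoints ℝ K) (hpa : p ≠ a) (hpb : p ≠ b) : ¬ Wbtw ℝ a p b := by
  intro h
  rw [← mem_segment_iff_wbtw] at h
  have := (mem_extremePoints_iff_forall_segment.1 hp).2 a ha b hb h
  rcases this with h | h
  · exact hpa h.symm
  · exact hpb h.symm

lemma not_collinear_of_extreme {K : Set E2} {a b p : E2} (ha : a ∈ Set.extremePoints ℝ K)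
    (hb : b ∈ Set.extremePoints ℝ K)
    (hp : p ∈ Set.extremePoints ℝ K) (hab : a ≠ b) (hpa : p ≠ a) (hpb : p ≠ b) :
    ¬ Collinear ℝ {a, b, p} := by
  intro h
  rcases h.wbtw_or_wbtw_or_wbtw with h | h | h
  · exact not_wbtw_of_extreme ha.1 hp.1 hb hab.symm hpb.symm h
  · exact not_wbtw_of_extreme hb.1 ha.1 hp hpb hpa h
  · exact not_wbtw_of_extreme hp.1 hb.1 ha hpa.symm hab h

/-- three points on a supporting line are collinear -/
lemma collinear_of_f (f : E2 →L[ℝ] ℝ) (M : ℝ) (a b c p : E2) (ha : f a = M) (hb : f b = M)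
    (hp : f p = M) (hc : f c < M) (hab : a ≠ b) : Collinear ℝ {a, b, p} := by
  have h1 := bary_f f M a b c p ha hb
  have hz : cr (b - a) (p - a) = 0 := by
    rw [hp, sub_self, mul_zero] at h1
    rcases mul_eq_zero.1 h1.symm with h | h
    · exact h
    · linarith
  rw [collinear_iff_of_mem (p₀ := a) (by simp)]
  refine ⟨b - a, ?_⟩
  have hL : 0 < ‖b - a‖ ^ 2 := by
    have := norm_pos_iff.2 (sub_ne_zero.2 hab.symm)
    positivity
  have hL2 : ‖b - a‖ ^ 2 = (b 0 - a 0) ^ 2 + (b 1 - a 1) ^ 2 := by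
    rw [EuclideanSpace.norm_sq_eq]
    simp [Fin.sum_univ_two]
  rw [hL2] at hL
  simp only [cr, PiLp.sub_apply] at hz
  intro q hq
  simp only [Set.mem_insert_iff, Set.mem_singleton_iff] at hq
  rcases hq with rfl | rfl | rfl
  · exact ⟨0, by simp⟩
  · exact ⟨1, by simp⟩
  · refine ⟨((b 0 - a 0) * (q 0 - a 0) + (b 1 - a 1) * (q 1 - a 1)) /
      ((b 0 - a 0) ^ 2 + (b 1 - a 1) ^ 2), ?_⟩
    ext i
    fin_cases i
    · simp; field_simp; linear_combination -(b 1 - a 1) * hz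
    · simp; field_simp; linear_combination (b 0 - a 0) * hz

/-- supporting functional at a non-interior point -/
lemma exists_support (K : Set E2) (hKc : Convex ℝ K) (hint : (interior K).Nonempty)
    (m : E2) (hmi : m ∉ interior K) :
    ∃ f : E2 →L[ℝ] ℝ, (∀ x ∈ K, f x ≤ f m) ∧ ∀ x ∈ interior K, f x < f m := by
  obtain ⟨f, hf⟩ := geometric_hahn_banach_open_point hKc.interior isOpen_interior hmi
  refine ⟨f, ?_, hf⟩
  intro x hx
  have h1 : x ∈ closure (interior K) := by
    rw [hKc.closure_interior_eq_closure_of_nonempty_interior hint]; exact subset_closure hx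
  have : closure (interior K) ⊆ {x | f x ≤ f m} :=
    closure_minimal (fun x hx => (hf x hx).le) (isClosed_le f.continuous continuous_const)
  exact this h1

lemma f_eq_of_openSegment {K : Set E2} (f : E2 →L[ℝ] ℝ) {M : ℝ} (hK : ∀ x ∈ K, f x ≤ M)
    {a b m : E2} (ha : a ∈ K) (hb : b ∈ K) (hm : m ∈ openSegment ℝ a b) (hfm : f m = M) :
    f a = M ∧ f b = M := by
  obtain ⟨s, t, hs, ht, hst, rfl⟩ := hm
  simp only [map_add, map_smul, smul_eq_mul] at hfm
  have h1 := hK a ha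
  have h2 := hK b hb
  have e : s * (M - f a) + t * (M - f b) = 0 := by linear_combination M * hst - hfm
  have h3 : 0 ≤ s * (M - f a) := mul_nonneg hs.le (by linarith)
  have h4 : 0 ≤ t * (M - f b) := mul_nonneg ht.le (by linarith)
  constructor
  · have : s * (M - f a) = 0 := by linarith
    rcases mul_eq_zero.1 this with h | h <;> linarith
  · have : t * (M - f b) = 0 := by linarith
    rcases mul_eq_zero.1 this with h | h <;> linarith

namespace ConvexPolygon

variable {n : ℕ} [NeZero n] (P : ConvexPolygon n)

lemma succ_ne (hn : 3 ≤ n) (i : Fin n) : i ≠ i + 1 := by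
  obtain ⟨m, rfl⟩ : ∃ m, n = m + 3 := ⟨n - 3, by omega⟩
  intro h
  have : (1 : Fin (m + 3)) = 0 := by simpa using h
  have := congrArg Fin.val this
  simp at this

lemma succ_succ_ne (hn : 3 ≤ n) (i : Fin n) : i ≠ i + 1 + 1 := by
  obtain ⟨m, rfl⟩ : ∃ m, n = m + 3 := ⟨n - 3, by omega⟩
  intro h
  have : (1 + 1 : Fin (m + 3)) = 0 := by rw [add_assoc] at h; simpa using h
  have := congrArg Fin.val this
  simp [Fin.val_add] at this
  rw [Nat.mod_eq_of_lt (by omega)] at this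
  omega

lemma region_convex : Convex ℝ P.region := convex_convexHull ℝ _

lemma region_compact : IsCompact P.region := (Set.finite_range P.v).isCompact_convexHull ℝ

lemma v_mem (i : Fin n) : P.v i ∈ P.region := (P.extreme i).1

lemma edge_not_interior (i : Fin n) {x : E2} (hx : x ∈ P.edge i) :
    x ∈ P.region ∧ x ∉ interior P.region := by
  have : x ∈ frontier P.region := by
    unfold region
    rw [P.boundary]
    exact Set.mem_iUnion.2 ⟨i, hx⟩
  rw [P.region_compact.isClosed.frontier_eq] at this
  exact this

lemma interior_nonempty (hinj : Function.Injective P.v) : (interior P.region).Nonempty := by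
  unfold region
  rw [interior_convexHull_nonempty_iff_affineSpan_eq_top]
  have hn := P.hn
  have h := not_collinear_of_extreme (P.extreme 0) (P.extreme (0 + 1)) (P.extreme (0 + 1 + 1))
    (fun h => succ_ne hn _ (hinj h))
    (fun h => succ_succ_ne hn _ (hinj h.symm)) (fun h => succ_ne hn _ (hinj h.symm))
  rw [← affineIndependent_iff_not_collinear_set] at h
  have h2 := h.affineSpan_eq_top_iff_card_eq_finrank_add_one.2 (by simp)
  rw [eq_top_iff, ← h2]
  apply affineSpan_mono
  rintro _ ⟨i, rfl⟩
  fin_cases i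
  · exact ⟨_, rfl⟩
  · exact ⟨_, rfl⟩
  · exact ⟨_, rfl⟩

lemma exists_ball (γ : ℝ) (hγ : 0 < γ) (hinj : Function.Injective P.v)
    (hdiam : Metric.diam P.region = 1) (h1 : P.G1 γ) :
    ∃ c, closedBall c (1 / γ) ⊆ P.region := by
  have hbdd : BddAbove {r : ℝ | ∃ c : E2, Metric.closedBall c r ⊆ P.region} := by
    refine ⟨1, ?_⟩
    rintro r ⟨c, hc⟩
    by_contra hr
    push Not at hr
    have hx : c + EuclideanSpace.single 0 r ∈ P.region := by
      apply hc; simp [abs_of_pos (by linarith : 0 < r)]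
    have hc' : c ∈ P.region := hc (mem_closedBall_self (by linarith))
    have := dist_le_diam_of_mem P.region_compact.isBounded hx hc'
    rw [hdiam] at this
    simp [abs_of_pos (by linarith : 0 < r)] at this
    linarith
  obtain ⟨c, hc⟩ := P.interior_nonempty hinj
  rw [mem_interior_iff_mem_nhds, Metric.nhds_basis_closedBall.mem_iff] at hc
  obtain ⟨ε, hε, hsub⟩ := hc
  have hpos : 0 < P.inradius := lt_of_lt_of_le hε (le_csSup hbdd ⟨c, hsub⟩)
  have h2 : 1 / γ < P.inradius := by
    unfold G1 at h1
    rw [hdiam, div_lt_iff₀ hpos] at h1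
    rw [div_lt_iff₀ hγ]; linarith
  obtain ⟨r, ⟨c, hc⟩, hr⟩ := exists_lt_of_lt_csSup (s := {r : ℝ | ∃ c : E2, Metric.closedBall c r ⊆ P.region})
    ⟨ε, c, hsub⟩ h2
  exact ⟨c, (closedBall_subset_closedBall hr.le).trans hc⟩

lemma near_vertex (r δ η : ℝ) (hr : 0 < r) (hδ : 0 < δ) (hη : η < δ * r)
    (hinj : Function.Injective P.v)
    (hdiam : Metric.diam P.region = 1) (c : E2) (hc : closedBall c r ⊆ P.region)
    (i j : Fin n) (hij : i ≠ j) (y z : E2) (hy : y ∈ P.edge i) (hz : z ∈ P.edge j)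
    (hyz : dist y z ≤ η) : ∃ k, (i = k ∨ i + 1 = k) ∧ dist y (P.v k) < δ := by
  by_contra hcon
  push Not at hcon
  have hya := hcon i (Or.inl rfl)
  have hyb := hcon (i + 1) (Or.inr rfl)
  have hn := P.hn
  have hab : P.v i ≠ P.v (i + 1) := fun h => succ_ne hn _ (hinj h)
  have hci : c ∈ interior P.region :=
    interior_mono hc (ball_subset_interior_closedBall (mem_ball_self hr))
  obtain ⟨hyK, hyi⟩ := P.edge_not_interior i hy
  obtain ⟨hzK, hzi⟩ := P.edge_not_interior j hz
  have hcK := interior_subset hci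
  have hdist : ∀ x ∈ P.region, dist c x ≤ 1 := fun x hx => by
    rw [← hdiam]; exact dist_le_diam_of_mem P.region_compact.isBounded hcK hx
  obtain ⟨f, hf, hfi⟩ := exists_support P.region P.region_convex ⟨c, hci⟩ y hyi
  have hyo : y ∈ openSegment ℝ (P.v i) (P.v (i + 1)) := by
    apply mem_openSegment_of_ne_left_right _ _ hy
    · rintro h; rw [← h, dist_self] at hya; linarith
    · rintro h; rw [← h, dist_self] at hyb; linarith
  obtain ⟨hfa, hfb⟩ := f_eq_of_openSegment f hf (P.v_mem _) (P.v_mem _) hyo rfl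
  have hzo := key P.region P.region_convex f (f y) hf (P.v i) (P.v (i + 1)) c (P.v_mem _)
    (P.v_mem _) r δ η hr hc hfa hfb (hfi c hci) hab y z hy hya hyb hyz hη (hdist _ (P.v_mem _))
    (hdist _ (P.v_mem _)) hzK hzi
  have hfz : f z = f y := by
    obtain ⟨s, t, hs, ht, hst, rfl⟩ := hzo
    simp only [map_add, map_smul, smul_eq_mul, hfa, hfb]
    rw [← add_mul, hst, one_mul]
  have hzne : ∀ k, P.v k ≠ z := by
    rintro k rfl
    have h1 := (mem_extremePoints.1 (P.extreme k)).2 _ (P.v_mem _) _ (P.v_mem _) hzo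
    exact hab (h1.1.trans h1.2.symm)
  have hzo' : z ∈ openSegment ℝ (P.v j) (P.v (j + 1)) :=
    mem_openSegment_of_ne_left_right (hzne _) (hzne _) hz
  obtain ⟨hfp, hfq⟩ := f_eq_of_openSegment f hf (P.v_mem _) (P.v_mem _) hzo' hfz
  have main : ∀ k, k ≠ i → k ≠ i + 1 → f (P.v k) = f y → False := fun k h1 h2 h3 =>
    not_collinear_of_extreme (P.extreme i) (P.extreme (i + 1)) (P.extreme k) hab
      (fun h => h1 (hinj h)) (fun h => h2 (hinj h))
      (collinear_of_f f (f y) _ _ c _ hfa hfb h3 (hfi c hci) hab)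
  by_cases hji : j = i + 1
  · refine main (j + 1) ?_ ?_ hfq
    · rw [hji]; exact (succ_succ_ne hn i).symm
    · rw [hji]; exact (succ_ne hn _).symm
  · exact main j hij.symm hji hfp

end ConvexPolygon

open ConvexPolygon in
/-- under G1 and G2 there is a uniform `h_* > 0` such that for every point
`x` of a unit-diameter convex polygon, the closed ball `B(x, h_*)` meets neither three
edges nor two non-adjacent edges. -/
theorem exists_separation_radius (γstar dstar : ℝ) (hγ : 0 < γstar) (hd : 0 < dstar) :
    ∃ hstar : ℝ, 0 < hstar ∧
      ∀ (n : ℕ) [NeZero n] (P : ConvexPolygon n),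
        Metric.diam P.region = 1 → P.G1 γstar → P.G2 dstar → P.SepProp hstar := by
  set δ := dstar / 4 with hδ
  have hδp : 0 < δ := by positivity
  have hr : 0 < 1 / γstar := by positivity
  refine ⟨min (δ * (1 / γstar) / 4) (δ / 4), by positivity, ?_⟩
  intro n _ P hdiam h1 h2
  set h := min (δ * (1 / γstar) / 4) (δ / 4) with hh
  have hl1 : h ≤ δ * (1 / γstar) / 4 := min_le_left _ _
  have hl2 : h ≤ δ / 4 := min_le_right _ _
  have hp : 0 < δ * (1 / γstar) := by positivity
  have hinj : Function.Injective P.v := by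
    intro i j hij
    by_contra hne
    have := h2 i j hne
    rw [hij, dist_self] at this
    linarith
  obtain ⟨c, hc⟩ := P.exists_ball γstar hγ hinj hdiam h1
  have near := P.near_vertex (1 / γstar) δ (2 * h) hr hδp (by linarith) hinj hdiam c hc
  have close : ∀ {x y z : E2}, y ∈ closedBall x h → z ∈ closedBall x h → dist y z ≤ 2 * h := by
    intro x y z hy hz
    rw [mem_closedBall] at hy hz
    linarith [dist_triangle_right y z x]
  have same : ∀ {y z : E2} {k l : Fin n}, dist y z ≤ 2 * h → dist y (P.v k) < δ →
      dist z (P.v l) < δ → k = l := by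
    intro y z k l h3 h4 h5
    by_contra hne
    have h6 := h2 k l hne
    have h7 := dist_triangle4 (P.v k) y z (P.v l)
    rw [dist_comm (P.v k) y] at h7
    linarith
  intro x _
  constructor
  · rintro i j k hij hjk hik ⟨⟨y, hyx, hy⟩, ⟨z, hzx, hz⟩, ⟨w, hwx, hw⟩⟩
    obtain ⟨p, hp, hpd⟩ := near i j hij y z hy hz (close hyx hzx)
    obtain ⟨q, hq, hqd⟩ := near j k hjk z w hz hw (close hzx hwx)
    obtain ⟨s, hs, hsd⟩ := near k i hik.symm w y hw hy (close hwx hyx)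
    obtain rfl := same (close hyx hzx) hpd hqd
    obtain rfl := same (close hyx hwx) hpd hsd
    rcases hp with hp | hp <;> rcases hq with hq | hq <;> rcases hs with hs | hs
    · exact hij (hp.trans hq.symm)
    · exact hij (hp.trans hq.symm)
    · exact hik (hp.trans hs.symm)
    · exact hjk (add_right_cancel (hq.trans hs.symm))
    · exact hjk (hq.trans hs.symm)
    · exact hik (add_right_cancel (hp.trans hs.symm))
    · exact hij (add_right_cancel (hp.trans hq.symm))
    · exact hij (add_right_cancel (hp.trans hq.symm))
  · rintro i j ⟨hij, hij1, hji1⟩ ⟨⟨y, hyx, hy⟩, ⟨z, hzx, hz⟩⟩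
    obtain ⟨p, hp, hpd⟩ := near i j hij y z hy hz (close hyx hzx)
    obtain ⟨q, hq, hqd⟩ := near j i hij.symm z y hz hy (close hzx hyx)
    obtain rfl := same (close hyx hzx) hpd hqd
    rcases hp with hp | hp <;> rcases hq with hq | hq
    · exact hij (hp.trans hq.symm)
    · exact hij1 (hp.trans hq.symm)
    · exact hji1 (hq.trans hp.symm)
    · exact hij (add_right_cancel (hp.trans hq.symm))
end
end

section
/- Let Ω be a convex polygon of diameter 1 satisfying G1 (γ < γ*) and G2 (|v_i − v_j| > d_* for all i ≠ j), and let h_* > 0 have the separation property for Ω. Then h_* < |v_i − v_{i−1}|/2 for every index i. -/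
open EuclideanGeometry Metric Real

noncomputable section

open ConvexPolygon in
/-- if `h_* > 0` has the separation property for a unit-diameter convex
polygon satisfying G1 and G2, then `h_* < |v_i − v_{i−1}|/2` for every `i`. -/
theorem sep_radius_lt_half_edge {n : ℕ} [NeZero n] (P : ConvexPolygon n)
    (γstar dstar hstar : ℝ) (hd : 0 < dstar)
    (hdiam : Metric.diam P.region = 1) (hG1 : P.G1 γstar) (hG2 : P.G2 dstar)
    (hpos : 0 < hstar) (hsep : P.SepProp hstar) :
    ∀ i : Fin n, hstar < dist (P.v i) (P.v (i - 1)) / 2 := by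
  intro i
  have hn := P.hn
  have ne1 : ∀ j : Fin n, j ≠ j - 1 := by
    intro j h
    have h1 : (1 : Fin n) = 0 := by
      have := congrArg (fun t => j - t) h
      simpa using this.symm
    have h2 := congrArg Fin.val h1
    rw [Fin.val_one', Fin.val_zero, Nat.mod_eq_of_lt (by omega)] at h2
    omega
  have ne2 : i ≠ i - 1 - 1 := by
    intro h
    have h1 : (1 : Fin n) + 1 = 0 := by
      have := congrArg (fun t => i - t) h
      simpa [sub_sub] using this.symm
    have h2 := congrArg Fin.val h1
    rw [Fin.val_add, Fin.val_one', Fin.val_zero, Nat.mod_eq_of_lt (a := 1) (by omega),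
      Nat.mod_eq_of_lt (by omega)] at h2
    omega
  by_contra hlt
  push Not at hlt
  have hvi : ∀ j, P.v j ∈ P.region := fun j => subset_convexHull ℝ _ ⟨j, rfl⟩
  have hm : midpoint ℝ (P.v i) (P.v (i - 1)) ∈ P.region :=
    (convex_convexHull ℝ _).midpoint_mem (hvi _) (hvi _)
  have b1 : P.v i ∈ Metric.closedBall (midpoint ℝ (P.v i) (P.v (i - 1))) hstar := by
    rw [Metric.mem_closedBall, dist_left_midpoint, Real.norm_eq_abs, abs_of_pos two_pos]
    linarith
  have b2 : P.v (i - 1) ∈ Metric.closedBall (midpoint ℝ (P.v i) (P.v (i - 1))) hstar := by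
    rw [Metric.mem_closedBall, dist_right_midpoint, Real.norm_eq_abs, abs_of_pos two_pos]
    linarith
  refine (hsep _ hm).1 i (i - 1) (i - 1 - 1) (ne1 i) (ne1 (i - 1)) ne2
    ⟨⟨_, b1, left_mem_segment ℝ _ _⟩, ⟨_, b2, left_mem_segment ℝ _ _⟩, ⟨_, b2, ?_⟩⟩
  have := right_mem_segment ℝ (P.v (i - 1 - 1)) (P.v (i - 1 - 1 + 1))
  rw [sub_add_cancel] at this
  unfold ConvexPolygon.edge
  rw [sub_add_cancel]
  exact this
end
end

section
/- Let Ω be a convex polygon of diameter 1 satisfying G1 (γ < γ*) and G2 (|v_i − v_j| > d_* for all i ≠ j), and let h_* > 0 have the separation property for Ω. If x ∈ Ω satisfies r_i(x) < h_* for some index i, then r_j(x) > h_* for all j ≠ i. -/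
open EuclideanGeometry Metric Real

noncomputable section

open ConvexPolygon in
/-- under G1 and G2, with `h_*` having the separation property, if
`r_i(x) < h_*` for some `i` then `r_j(x) > h_*` for all `j ≠ i`. -/
theorem at_most_one_small_r {n : ℕ} [NeZero n] (P : ConvexPolygon n)
    (γstar dstar hstar : ℝ) (hd : 0 < dstar)
    (hdiam : Metric.diam P.region = 1) (hG1 : P.G1 γstar) (hG2 : P.G2 dstar)
    (hpos : 0 < hstar) (hsep : P.SepProp hstar)
    (x : E2) (hx : x ∈ P.region) (i : Fin n) (hi : P.r i x < hstar) :
    ∀ j : Fin n, j ≠ i → hstar < P.r j x := by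
  intro j hji
  by_contra hcon
  have hj : P.r j x ≤ hstar := not_lt.mp hcon
  have hi' : P.r i x ≤ hstar := hi.le
  have key : ∀ k : Fin n, P.r k x ≤ hstar →
      (Metric.closedBall x hstar ∩ P.edge k).Nonempty ∧
      (Metric.closedBall x hstar ∩ P.edge (k - 1)).Nonempty := by
    intro k hk
    have hb : P.v k ∈ Metric.closedBall x hstar := by
      rw [Metric.mem_closedBall, dist_comm]
      exact hk
    refine ⟨⟨P.v k, hb, left_mem_segment ℝ _ _⟩, ⟨P.v k, hb, ?_⟩⟩
    unfold ConvexPolygon.edge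
    rw [sub_add_cancel]
    exact right_mem_segment ℝ _ _
  obtain ⟨hi1, hi2⟩ := key i hi'
  obtain ⟨hj1, hj2⟩ := key j hj
  have hn := P.hn
  have h1 : (1 : Fin n) ≠ 0 := by
    intro h
    have h' := congrArg Fin.val h
    rw [Fin.coe_ofNat_eq_mod, Fin.coe_ofNat_eq_mod, Nat.zero_mod, Nat.mod_eq_of_lt (by omega)] at h'
    omega
  have h2 : (1 : Fin n) + 1 ≠ 0 := by
    intro h
    have h' := congrArg Fin.val h
    rw [Fin.val_add, Fin.coe_ofNat_eq_mod, Fin.coe_ofNat_eq_mod, Nat.zero_mod, Nat.mod_eq_of_lt (by omega : 1 < n),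
      Nat.mod_eq_of_lt (by omega)] at h'
    omega
  have hs := (hsep x hx).1
  have hne : ∀ k : Fin n, k ≠ k - 1 := fun k h => h1 (sub_eq_self.mp h.symm)
  by_cases hc : j = i - 1
  · refine hs i (i - 1) (j - 1) (hne i) (hc ▸ hne j) ?_ ⟨hi1, hi2, hj2⟩
    intro h
    rw [hc, sub_sub] at h
    exact h2 (sub_eq_self.mp h.symm)
  · exact hs i (i - 1) j (hne i) (fun h => hc h.symm) (fun h => hji h.symm) ⟨hi1, hi2, hj1⟩
end
end

section
/- Let Ω be a convex polygon of diameter 1 satisfying G1 (γ < γ*) and G2 (|v_i − v_j| > d_* for all i ≠ j), let β_* > 0 be such that every interior angle satisfies β_i > β_*, let h_* > 0 have the separation property for Ω, and set α* := max(π − β_*/2, 2·arctan(1/h_*)). If x is in the interior of Ω and α_i(x) > α* for some index i, then α_j(x) < α* for all j ≠ i. -/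
open EuclideanGeometry Metric Real

noncomputable section

lemma near_edge {A B x : E2} {h : ℝ} (hh : 0 < h) (hA : A ≠ x) (hB : B ≠ x)
    (hc : dist A B ≤ 1) (hang : 2 * Real.arctan (1 / h) ≤ ∠ A x B) :
    (Metric.closedBall x h ∩ segment ℝ A B).Nonempty := by
  have ha : 0 < ‖A - x‖ := norm_pos_iff.2 (sub_ne_zero.2 hA)
  have hb : 0 < ‖B - x‖ := norm_pos_iff.2 (sub_ne_zero.2 hB)
  have hcos := InnerProductGeometry.cos_angle_mul_norm_mul_norm (A - x) (B - x)
  have hθ : ∠ A x B = InnerProductGeometry.angle (A - x) (B - x) := rfl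
  rw [← hθ] at hcos
  have hπ : ∠ A x B ≤ π := EuclideanGeometry.angle_le_pi _ _ _
  have hAB : ‖(A - x) - (B - x)‖ ≤ 1 := by
    rw [sub_sub_sub_cancel_right, ← dist_eq_norm]; exact hc
  generalize ∠ A x B = θ at *
  have hat0 : 0 < Real.arctan (1 / h) := Real.arctan_pos.2 (by positivity)
  have hC0 : 0 ≤ Real.cos (θ / 2) := Real.cos_nonneg_of_mem_Icc ⟨by linarith, by linarith⟩
  have h1 : Real.cos (θ / 2) ≤ Real.cos (Real.arctan (1 / h)) :=
    Real.cos_le_cos_of_nonneg_of_le_pi hat0.le (by linarith) (by linarith)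
  have h2 : Real.sin (Real.arctan (1 / h)) ≤ Real.sin (θ / 2) :=
    Real.sin_le_sin_of_le_of_le_pi_div_two (by linarith) (by linarith) (by linarith)
  have h3 : Real.cos (Real.arctan (1 / h)) = h * Real.sin (Real.arctan (1 / h)) := by
    rw [Real.sin_arctan, Real.cos_arctan]; field_simp
  have hCS : Real.cos (θ / 2) ≤ h * Real.sin (θ / 2) := by
    rw [h3] at h1; exact h1.trans (mul_le_mul_of_nonneg_left h2 hh.le)
  have hS0 : 0 ≤ Real.sin (θ / 2) := Real.sin_nonneg_of_nonneg_of_le_pi (by linarith) (by linarith)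
  have hsq := Real.sin_sq_add_cos_sq (θ / 2)
  have hdbl : Real.cos θ = 2 * Real.cos (θ / 2) ^ 2 - 1 := by
    rw [← Real.cos_two_mul]; ring_nf
  have hnsub := norm_sub_sq_real (A - x) (B - x)
  have hnadd := norm_add_sq_real (‖B - x‖ • (A - x)) (‖A - x‖ • (B - x))
  rw [inner_smul_left, inner_smul_right, norm_smul, norm_smul, norm_norm, norm_norm] at hnadd
  simp only [conj_trivial] at hnadd
  refine ⟨(‖B - x‖ / (‖A - x‖ + ‖B - x‖)) • A + (‖A - x‖ / (‖A - x‖ + ‖B - x‖)) • B, ?_,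
    _, _, by positivity, by positivity, by field_simp; ring, rfl⟩
  have hp : (‖B - x‖ / (‖A - x‖ + ‖B - x‖)) • A + (‖A - x‖ / (‖A - x‖ + ‖B - x‖)) • B - x
      = (‖A - x‖ + ‖B - x‖)⁻¹ • (‖B - x‖ • (A - x) + ‖A - x‖ • (B - x)) := by
    have hx : x = ((‖A - x‖ + ‖B - x‖)⁻¹ * (‖A - x‖ + ‖B - x‖)) • x := by
      rw [inv_mul_cancel₀ (by positivity), one_smul]
    generalize ‖A - x‖ = a at *
    generalize ‖B - x‖ = b at *
    nth_rewrite 1 [hx]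
    module
  rw [mem_closedBall, dist_eq_norm, hp, norm_smul, Real.norm_eq_abs, abs_of_pos (by positivity),
    inv_mul_le_iff₀ (by positivity)]
  rw [← hcos, hdbl] at hnsub hnadd
  generalize ‖A - x‖ = a at *
  generalize ‖B - x‖ = b at *
  generalize Real.cos (θ / 2) = C at *
  generalize Real.sin (θ / 2) = S at *
  have hN : ‖b • (A - x) + a • (B - x)‖ ^ 2 = (2 * a * b * C) ^ 2 := by rw [hnadd]; ring
  have hN' := (sq_eq_sq₀ (norm_nonneg _) (by positivity)).1 hN
  rw [hN']
  have hc2 : ‖(A - x) - (B - x)‖ ^ 2 ≤ 1 := by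
    have := norm_nonneg ((A - x) - (B - x)); nlinarith
  have hS4 : 4 * (a * b) * S ^ 2 ≤ 1 := by
    have : S ^ 2 = 1 - C ^ 2 := by linarith
    rw [this]; nlinarith [sq_nonneg (a - b)]
  have hab : 0 < a * b := mul_pos ha hb
  have hfin : 2 * a * b * S ≤ a + b := by
    apply (fun h h' => (pow_le_pow_iff_left₀ (by positivity) h' two_ne_zero).1 h) _ (by positivity)
    nlinarith [mul_le_mul_of_nonneg_left hS4 hab.le]
  calc 2 * a * b * C ≤ 2 * a * b * (h * S) := by gcongr
    _ = (2 * a * b * S) * h := by ring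
    _ ≤ (a + b) * h := by gcongr

lemma angle_pair {a b c x : E2} (hab : a ≠ b) (hcb : c ≠ b) :
    ∠ a b c + ∠ a x b + ∠ b x c ≤ 2 * π := by
  have h1 := EuclideanGeometry.angle_add_angle_add_angle_eq_pi x hab
  have h2 := EuclideanGeometry.angle_add_angle_add_angle_eq_pi x hcb
  have h3 := EuclideanGeometry.angle_le_angle_add_angle b a x c
  rw [EuclideanGeometry.angle_comm a b x] at h3
  rw [EuclideanGeometry.angle_comm c x b] at h2
  have h4 := EuclideanGeometry.angle_nonneg b a x
  have h5 := EuclideanGeometry.angle_nonneg b c x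
  linarith

open ConvexPolygon in
/-- under G1 and G2, with minimum interior angle `β_*`, separation radius
`h_*`, and `α* := max(π − β_*/2, 2 arctan(1/h_*))`: if `α_i(x) > α*` then `α_j(x) < α*`
for all `j ≠ i`. -/
theorem at_most_one_large_alpha {n : ℕ} [NeZero n] (P : ConvexPolygon n)
    (γstar dstar βstar hstar : ℝ) (hd : 0 < dstar)
    (hdiam : Metric.diam P.region = 1) (hG1 : P.G1 γstar) (hG2 : P.G2 dstar)
    (hβpos : 0 < βstar) (hβ : ∀ i : Fin n, βstar < P.interiorAngle i)
    (hpos : 0 < hstar) (hsep : P.SepProp hstar)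
    (x : E2) (hx : x ∈ interior P.region) (i : Fin n)
    (hi : max (Real.pi - βstar / 2) (2 * Real.arctan (1 / hstar)) < P.angleAt i x) :
    ∀ j : Fin n, j ≠ i →
      P.angleAt j x < max (Real.pi - βstar / 2) (2 * Real.arctan (1 / hstar)) := by
  have hxv : ∀ k, P.v k ≠ x := by
    intro k hk
    have h1 : P.v k ∈ frontier P.region := by
      have : frontier P.region = ⋃ i, segment ℝ (P.v i) (P.v (i + 1)) := P.boundary
      rw [this]
      exact Set.mem_iUnion.2 ⟨k, left_mem_segment ℝ _ _⟩
    rw [hk] at h1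
    exact h1.2 hx
  have hb : Bornology.IsBounded P.region := by
    by_contra hb
    rw [Metric.diam_eq_zero_of_unbounded hb] at hdiam
    exact zero_ne_one hdiam
  have hvm : ∀ k, P.v k ∈ P.region := fun k => subset_convexHull ℝ _ ⟨k, rfl⟩
  have hlen : ∀ k, dist (P.v k) (P.v (k + 1)) ≤ 1 := fun k =>
    hdiam ▸ Metric.dist_le_diam_of_mem hb (hvm _) (hvm _)
  have hne : ∀ k : Fin n, P.v k ≠ P.v (k + 1) := by
    intro k hk
    have h3 := P.hn
    have hkk : k ≠ k + 1 := by
      intro h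
      have h0 : (1 : Fin n) = 0 := by simpa using h.symm
      have := congrArg Fin.val h0
      rw [Fin.val_one', Fin.val_zero, Nat.mod_eq_of_lt (by omega)] at this
      omega
    have := hG2 _ _ hkk
    rw [hk, dist_self] at this
    linarith
  have key : ∀ k : Fin n, P.angleAt k x + P.angleAt (k + 1) x < 2 * π - βstar := by
    intro k
    have h1 := hβ (k + 1)
    have h2 := angle_pair (x := x) (hne k) (hne (k + 1)).symm
    unfold ConvexPolygon.interiorAngle at h1
    rw [add_sub_cancel_right] at h1
    unfold ConvexPolygon.angleAt
    linarith
  intro j hji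
  by_contra hj
  push Not at hj
  have near : ∀ k, max (Real.pi - βstar / 2) (2 * Real.arctan (1 / hstar)) ≤ P.angleAt k x →
      (Metric.closedBall x hstar ∩ P.edge k).Nonempty := fun k hk =>
    near_edge hpos (hxv _) (hxv _) (hlen k) ((le_max_right _ _).trans hk)
  have hm := le_max_left (Real.pi - βstar / 2) (2 * Real.arctan (1 / hstar))
  refine (hsep x (interior_subset hx)).2 i j ⟨hji.symm, ?_, ?_⟩ ⟨near i hi.le, near j hj⟩
  · rintro rfl
    linarith [key j]
  · rintro rfl
    linarith [key i]
end
end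

section
/- Let Ω be a convex polygon of diameter 1 satisfying G1 (γ < γ*) and G2 (|v_i − v_j| > d_* for all i ≠ j), let β_* > 0 be such that every interior angle satisfies β_i > β_*, let h_* > 0 have the separation property for Ω, and set α* := max(π − β_*/2, 2·arctan(1/h_*)). If x is in the interior of Ω, α_i(x) > α*, and r_j(x) < h_*, then j = i or j = i+1 (indices modulo n). -/
open EuclideanGeometry Metric Real

noncomputable section

theorem trig_aux (h θ : ℝ) (hpos : 0 < h) (hθ : 2 * Real.arctan (1 / h) < θ) (hπ : θ ≤ Real.pi) :
    1 + Real.cos θ ≤ h ^ 2 * (1 - Real.cos θ) := by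
  obtain ⟨u, rfl⟩ : ∃ u, θ = 2 * u := ⟨θ / 2, by ring⟩
  have hφ0 : 0 < Real.arctan (1 / h) := Real.arctan_pos.2 (by positivity)
  have hφ1 := Real.arctan_lt_pi_div_two (1 / h)
  have htan := Real.tan_arctan (1 / h)
  set φ := Real.arctan (1 / h)
  have hc : 0 < Real.cos φ := Real.cos_pos_of_mem_Ioo ⟨by linarith, hφ1⟩
  have hs : 0 < Real.sin φ := Real.sin_pos_of_pos_of_lt_pi hφ0 (by linarith)
  have h1 : Real.cos φ = h * Real.sin φ := by
    rw [Real.tan_eq_sin_div_cos] at htan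
    field_simp at htan
    linarith
  have h2 : 0 < Real.sin (u - φ) := Real.sin_pos_of_pos_of_lt_pi (by linarith) (by linarith)
  rw [Real.sin_sub, h1] at h2
  have h3 : Real.cos u ≤ h * Real.sin u := by
    by_contra hcon
    push Not at hcon
    nlinarith [mul_lt_mul_of_pos_right hcon hs]
  have h4 : 0 ≤ Real.cos u := Real.cos_nonneg_of_mem_Icc ⟨by linarith, by linarith⟩
  have h5 : Real.cos u ^ 2 ≤ (h * Real.sin u) ^ 2 := pow_le_pow_left₀ h4 h3 2
  have h6 := Real.sin_sq_add_cos_sq u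
  rw [Real.cos_two_mul]
  have h7 : 1 - (2 * Real.cos u ^ 2 - 1) = 2 * Real.sin u ^ 2 := by linarith
  rw [h7]
  nlinarith

theorem near_segment (x p q : E2) (h : ℝ) (hpos : 0 < h) (hpq : dist p q ≤ 1)
    (hang : 2 * Real.arctan (1 / h) < ∠ p x q) :
    (Metric.closedBall x h ∩ segment ℝ p q).Nonempty := by
  by_cases hA : p = x
  · exact ⟨p, by simp [hA, hpos.le], left_mem_segment ℝ p q⟩
  by_cases hB : q = x
  · exact ⟨q, by simp [hB, hpos.le], right_mem_segment ℝ p q⟩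
  have hT := trig_aux h _ hpos hang (EuclideanGeometry.angle_le_pi p x q)
  have hc1 := Real.neg_one_le_cos (∠ p x q)
  have hin : inner ℝ (p - x) (q - x) = ‖p - x‖ * ‖q - x‖ * Real.cos (∠ p x q) := by
    have := InnerProductGeometry.cos_angle_mul_norm_mul_norm (p - x) (q - x)
    simp only [EuclideanGeometry.angle, vsub_eq_sub]
    linarith
  have hA' : 0 < ‖p - x‖ := norm_pos_iff.2 (sub_ne_zero.2 hA)
  have hB' : 0 < ‖q - x‖ := norm_pos_iff.2 (sub_ne_zero.2 hB)
  have hd : ‖(p - x) - (q - x)‖ ^ 2 ≤ 1 := by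
    rw [sub_sub_sub_cancel_right, ← dist_eq_norm]
    exact pow_le_one₀ dist_nonneg hpq
  rw [norm_sub_sq_real, hin] at hd
  have hsq : ‖‖q - x‖ • (p - x) + ‖p - x‖ • (q - x)‖ ^ 2
      = 2 * ‖p - x‖ ^ 2 * ‖q - x‖ ^ 2 * (1 + Real.cos (∠ p x q)) := by
    rw [norm_add_sq_real, norm_smul, norm_smul, real_inner_smul_left, real_inner_smul_right, hin]
    simp only [norm_norm]
    ring
  set A := ‖p - x‖
  set B := ‖q - x‖
  set c := Real.cos (∠ p x q)
  have hAB : 0 < A + B := by linarith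
  refine ⟨(B / (A + B)) • p + (A / (A + B)) • q, ?_,
    ⟨B / (A + B), A / (A + B), by positivity, by positivity, by field_simp; ring, rfl⟩⟩
  have he : (B / (A + B)) • p + (A / (A + B)) • q - x
      = (A + B)⁻¹ • (B • (p - x) + A • (q - x)) := by
    have : x = (A + B)⁻¹ • ((A + B) • x) := by
      rw [smul_smul, inv_mul_cancel₀ hAB.ne', one_smul]
    nth_rw 1 [this]
    module
  rw [Metric.mem_closedBall, dist_eq_norm, he, norm_smul, norm_inv, Real.norm_of_nonneg hAB.le,
    inv_mul_le_iff₀ hAB]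
  refine abs_le_of_sq_le_sq' ?_ (by positivity) |>.2
  rw [hsq]
  have hABp : 0 < A * B := mul_pos hA' hB'
  have k1 : 2 * A * B * (1 - c) ≤ 1 := by nlinarith [sq_nonneg (A - B)]
  calc 2 * A ^ 2 * B ^ 2 * (1 + c) ≤ 2 * A ^ 2 * B ^ 2 * (h ^ 2 * (1 - c)) := by gcongr
    _ = h ^ 2 * (A * B) * (2 * A * B * (1 - c)) := by ring
    _ ≤ h ^ 2 * (A * B) * 1 := by gcongr
    _ ≤ ((A + B) * h) ^ 2 := by nlinarith [mul_pos (pow_pos hpos 2) hABp, sq_nonneg (A*h), sq_nonneg (B*h)]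

open ConvexPolygon in
/-- under G1 and G2, with minimum interior angle `β_*`, separation radius
`h_*`, and `α* := max(π − β_*/2, 2 arctan(1/h_*))`: if `α_i(x) > α*` and `r_j(x) < h_*`
then `j = i` or `j = i + 1`. -/
theorem large_alpha_small_r_adjacent {n : ℕ} [NeZero n] (P : ConvexPolygon n)
    (γstar dstar βstar hstar : ℝ) (hd : 0 < dstar)
    (hdiam : Metric.diam P.region = 1) (hG1 : P.G1 γstar) (hG2 : P.G2 dstar)
    (hβpos : 0 < βstar) (hβ : ∀ i : Fin n, βstar < P.interiorAngle i)
    (hpos : 0 < hstar) (hsep : P.SepProp hstar)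
    (x : E2) (hx : x ∈ interior P.region) (i j : Fin n)
    (hi : max (Real.pi - βstar / 2) (2 * Real.arctan (1 / hstar)) < P.angleAt i x)
    (hj : P.r j x < hstar) :
    j = i ∨ j = i + 1 := by
  have hn := P.hn
  have h10 : (1 : Fin n) ≠ 0 := by
    intro h
    have := congrArg Fin.val h
    rw [Fin.val_one', Fin.val_zero, Nat.mod_eq_of_lt (by omega)] at this
    omega
  have hmem : ∀ k, P.v k ∈ P.region := fun k => subset_convexHull ℝ _ ⟨k, rfl⟩
  have hbd : Bornology.IsBounded P.region :=
    isBounded_convexHull.2 (Set.finite_range P.v).isBounded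
  have hlen : dist (P.v i) (P.v (i + 1)) ≤ 1 :=
    hdiam ▸ Metric.dist_le_diam_of_mem hbd (hmem _) (hmem _)
  have he := near_segment x _ _ hstar hpos hlen (lt_of_le_of_lt (le_max_right _ _) hi)
  by_contra hcon
  push Not at hcon
  have hball : P.v j ∈ Metric.closedBall x hstar := by
    rw [Metric.mem_closedBall, dist_comm]
    exact hj.le
  refine (hsep x (interior_subset hx)).1 i (j - 1) j ?_ ?_ (Ne.symm hcon.1)
    ⟨he, ⟨P.v j, hball, ?_⟩, ⟨P.v j, hball, left_mem_segment ℝ _ _⟩⟩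
  · rintro h
    exact hcon.2 (by rw [h]; simp)
  · intro h
    exact h10 (by simpa using h)
  · have := right_mem_segment ℝ (P.v (j - 1)) (P.v (j - 1 + 1))
    rw [edge, sub_add_cancel]
    rwa [sub_add_cancel] at this
end
end

section
/- Let Ω be a convex polygon of diameter 1 satisfying G1 (γ < γ*) and G2 (|v_i − v_j| > d_* for all i ≠ j), and let h_* > 0 have the separation property for Ω. If x is in the interior of Ω and r_i(x) < h_* for some index i, then α_{i−1}(x) + α_i(x) > 2π/3. -/
open EuclideanGeometry Metric Real

noncomputable section

open EuclideanGeometry in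
theorem aux_fin_ne {n : ℕ} [NeZero n] (hn : 3 ≤ n) (i : Fin n) :
    i ≠ i + 1 ∧ i - 1 ≠ i ∧ i - 1 ≠ i + 1 ∧ i - 1 + 1 = i := by
  obtain ⟨m, rfl⟩ : ∃ m, n = m + 3 := ⟨n - 3, by omega⟩
  have h1 : (1 : Fin (m+3)) ≠ 0 := by simp [Fin.ext_iff]
  have h2 : (1 + 1 : Fin (m+3)) ≠ 0 := by
    simp only [ne_eq, Fin.ext_iff, Fin.val_add, Fin.val_one, Fin.val_zero]
    rw [Nat.mod_eq_of_lt (by omega)]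
    omega
  have h4 : i - 1 + 1 = i := by simp
  refine ⟨fun h => h1 ?_, fun h => h1 ?_, fun h => h2 ?_, h4⟩
  · simpa using h
  · simpa using h
  · rw [sub_eq_iff_eq_add, add_assoc] at h
    simpa using h

theorem aux_support {n : ℕ} [NeZero n] (P : ConvexPolygon n) (x : E2)
    (hx : x ∈ interior P.region) (j : Fin n) :
    ∃ f : E2 →L[ℝ] ℝ, f (P.v j) = f (P.v (j + 1)) ∧ (∀ y ∈ P.region, f y ≤ f (P.v j)) ∧
      f x < f (P.v j) := by
  have hconv : Convex ℝ P.region := convex_convexHull ℝ _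
  set m := midpoint ℝ (P.v j) (P.v (j+1)) with hm
  have hmf : m ∈ frontier P.region := by
    have := P.boundary
    unfold ConvexPolygon.region
    rw [this]
    exact Set.mem_iUnion.2 ⟨j, midpoint_mem_segment _ _⟩
  have hmi : m ∉ interior P.region := hmf.2
  obtain ⟨f, hf⟩ := geometric_hahn_banach_open_point hconv.interior isOpen_interior hmi
  have hle : ∀ y ∈ P.region, f y ≤ f m := by
    intro y hy
    have hcl : P.region ⊆ closure (interior P.region) := by
      rw [hconv.closure_interior_eq_closure_of_nonempty_interior ⟨x, hx⟩]
      exact subset_closure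
    have hc : IsClosed {y | f y ≤ f m} := isClosed_le f.continuous continuous_const
    exact closure_minimal (fun z hz => (hf z hz).le) hc (hcl hy)
  have hv : ∀ k, P.v k ∈ P.region := fun k => subset_convexHull ℝ _ ⟨k, rfl⟩
  have e : f m = (f (P.v j) + f (P.v (j+1))) / 2 := by
    rw [hm, midpoint_eq_smul_add]; simp; ring
  have a1 := hle _ (hv j)
  have a2 := hle _ (hv (j+1))
  refine ⟨f, by linarith, fun y hy => by linarith [hle y hy], by linarith [hf x hx]⟩

theorem aux_len {n : ℕ} [NeZero n] (P : ConvexPolygon n) (h : ℝ) (hsep : P.SepProp h) (j : Fin n) :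
    2 * h < dist (P.v j) (P.v (j + 1)) := by
  by_contra! hc
  obtain ⟨n1, n2, n3, e4⟩ := aux_fin_ne P.hn j
  have hv : ∀ k, P.v k ∈ P.region := fun k => subset_convexHull ℝ _ ⟨k, rfl⟩
  have hmr : midpoint ℝ (P.v j) (P.v (j+1)) ∈ P.region :=
    (convex_convexHull ℝ _).segment_subset (hv _) (hv _) (midpoint_mem_segment _ _)
  have d1 : P.v j ∈ Metric.closedBall (midpoint ℝ (P.v j) (P.v (j+1))) h := by
    rw [Metric.mem_closedBall, dist_left_midpoint]; norm_num; linarith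
  have d2 : P.v (j+1) ∈ Metric.closedBall (midpoint ℝ (P.v j) (P.v (j+1))) h := by
    rw [Metric.mem_closedBall, dist_right_midpoint]; norm_num; linarith
  refine (hsep _ hmr).1 (j-1) j (j+1) n2 n1 n3 ⟨⟨_, d1, ?_⟩, ⟨_, d1, ?_⟩, ⟨_, d2, ?_⟩⟩
  · unfold ConvexPolygon.edge; rw [e4]; exact right_mem_segment _ _ _
  · exact left_mem_segment _ _ _
  · exact left_mem_segment _ _ _

/-- The angle opposite a side less than half of an adjacent one is less than `π/6`. -/
theorem aux_small_angle (x a b : E2) (h : 2 * dist x a < dist a b) (hxb : x ≠ b) :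
    ∠ x b a < π / 6 := by
  by_contra! hc
  have hcos : Real.cos (∠ x b a) ≤ √3 / 2 := by
    rw [← Real.cos_pi_div_six]
    exact Real.cos_le_cos_of_nonneg_of_le_pi (by positivity) (angle_le_pi _ _ _) hc
  have law := EuclideanGeometry.law_cos x b a
  have hr := dist_nonneg (x := x) (y := a)
  have hR : 0 < dist x b := dist_pos.2 hxb
  have hL : 0 < dist a b := by linarith
  have s3 : √3 ^ 2 = 3 := Real.sq_sqrt (by norm_num)
  have := mul_le_mul_of_nonneg_left hcos (mul_pos hR hL).le
  nlinarith [sq_nonneg (dist x b - √3 / 2 * dist a b)]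

theorem aux_angle_sum (u p q : E2) (s t : ℝ) (hs : 0 < s) (ht : 0 < t) (hu : u = s • p + t • q)
    (hu0 : u ≠ 0) (hp0 : p ≠ 0) (hq0 : q ≠ 0) :
    InnerProductGeometry.angle p u + InnerProductGeometry.angle u q ≤ π := by
  have key : InnerProductGeometry.angle u q ≤ π - InnerProductGeometry.angle p u := by
    by_contra! hc
    have h1 := Real.cos_lt_cos_of_nonneg_of_le_pi
      (by linarith [InnerProductGeometry.angle_le_pi p u]) (InnerProductGeometry.angle_le_pi u q) hc
    rw [Real.cos_pi_sub] at h1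
    set c := Real.cos (InnerProductGeometry.angle p u) with hcdef
    have hpu : inner ℝ p u = c * (‖p‖ * ‖u‖) :=
      (InnerProductGeometry.cos_angle_mul_norm_mul_norm p u).symm
    have huq := InnerProductGeometry.cos_angle_mul_norm_mul_norm u q
    have hpp := norm_pos_iff.2 hp0
    have hqp := norm_pos_iff.2 hq0
    have hup := norm_pos_iff.2 hu0
    have e : t • q = u - s • p := by rw [hu]; abel
    have e1 : t * inner ℝ u q = ‖u‖^2 - s * inner ℝ p u := by
      rw [← inner_smul_right, e, inner_sub_right, inner_smul_right, real_inner_self_eq_norm_sq,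
        real_inner_comm]
    have n1 : t * ‖q‖ = ‖u - s • p‖ := by rw [← e, norm_smul, Real.norm_of_nonneg ht.le]
    have n2 : ‖s • p‖ = s * ‖p‖ := by rw [norm_smul, Real.norm_of_nonneg hs.le]
    have t1 : ‖u - s • p‖ ≤ ‖u‖ + s * ‖p‖ := n2 ▸ norm_sub_le _ _
    have t2 : s * ‖p‖ - ‖u‖ ≤ ‖u - s • p‖ := by
      rw [← n2, norm_sub_rev]; exact norm_sub_norm_le _ _
    rw [← n1] at t1 t2
    have c1 : c ≤ 1 := Real.cos_le_one _
    have c2 : -1 ≤ c := Real.neg_one_le_cos _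
    have k1 : inner ℝ u q < -c * (‖u‖ * ‖q‖) := by
      rw [← huq]; exact mul_lt_mul_of_pos_right h1 (by positivity)
    have k2 : t * inner ℝ u q < t * (-c * (‖u‖ * ‖q‖)) := mul_lt_mul_of_pos_left k1 ht
    rw [e1, hpu] at k2
    have k3 : ‖u‖ * (‖u‖ - s * c * ‖p‖) < ‖u‖ * (-c * (t * ‖q‖)) := by nlinarith
    have k4 := lt_of_mul_lt_mul_left k3 hup.le
    rcases le_total 0 c with h | h
    · nlinarith
    · nlinarith
  linarith

theorem aux_cramer (u p q : E2) (h : p 0 * q 1 - p 1 * q 0 ≠ 0) :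
    ∃ s t : ℝ, u = s • p + t • q := by
  refine ⟨(u 0 * q 1 - u 1 * q 0) / (p 0 * q 1 - p 1 * q 0),
    (p 0 * u 1 - p 1 * u 0) / (p 0 * q 1 - p 1 * q 0), ?_⟩
  set D := p 0 * q 1 - p 1 * q 0 with hD
  ext k
  fin_cases k <;> simp <;> field_simp <;> rw [hD] <;> ring

/-- If the cross product vanishes, the vectors are parallel. -/
theorem aux_parallel (p q : E2) (hp : p ≠ 0) (h : p 0 * q 1 - p 1 * q 0 = 0) :
    ∃ c : ℝ, q = c • p := by
  have hp' : p 0 ≠ 0 ∨ p 1 ≠ 0 := by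
    by_contra! hc
    apply hp
    ext k
    fin_cases k
    · exact hc.1
    · exact hc.2
  rcases hp' with h0 | h0
  · refine ⟨q 0 / p 0, ?_⟩
    ext k
    fin_cases k <;> simp <;> field_simp
    linarith
  · refine ⟨q 1 / p 1, ?_⟩
    ext k
    fin_cases k <;> simp <;> field_simp
    linarith

theorem aux_not_between {A : Set E2} (a b c : E2) (hb : b ∈ A) (hc : c ∈ A)
    (ha : a ∈ Set.extremePoints ℝ A) (hba : b ≠ a) (s : ℝ) (h0 : 0 < s) (h1 : s < 1)
    (e : a = (1 - s) • b + s • c) : False :=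
  hba (ha.2 hb hc ⟨1 - s, s, by linarith, h0, by ring, e.symm⟩)

theorem aux_indep {A : Set E2} (a b c : E2)
    (ha : a ∈ Set.extremePoints ℝ A) (hb : b ∈ Set.extremePoints ℝ A)
    (hc : c ∈ Set.extremePoints ℝ A) (hab : a ≠ b) (hac : a ≠ c) (hbc : b ≠ c) :
    (b - a) 0 * (c - a) 1 - (b - a) 1 * (c - a) 0 ≠ 0 := by
  intro h
  obtain ⟨k, hk⟩ := aux_parallel _ _ (sub_ne_zero.2 hab.symm) h
  have hk' : c = (1 - k) • a + k • b := by
    rw [sub_eq_iff_eq_add] at hk; rw [hk]; module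
  have k0 : k ≠ 0 := by rintro rfl; apply hac; rw [hk']; simp
  have k1 : k ≠ 1 := by rintro rfl; apply hbc; rw [hk']; simp
  rcases lt_or_gt_of_ne k0 with h0 | h0
  · -- a between b and c
    have hpos : 0 < 1 - k := by linarith
    refine aux_not_between a b c hb.1 hc.1 ha hab.symm (1 / (1 - k)) (by positivity)
      (by rw [div_lt_one hpos]; linarith) ?_
    rw [hk']
    ext i
    simp
    field_simp
    ring
  · rcases lt_or_gt_of_ne k1 with h1 | h1
    · exact aux_not_between c a b ha.1 hb.1 hc hac k h0 h1 hk'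
    · refine aux_not_between b a c ha.1 hc.1 hb hab (1 / k) (by positivity)
        (by rw [div_lt_one h0]; linarith) ?_
      rw [hk']
      ext i
      simp
      field_simp
      ring

open ConvexPolygon in
/-- under G1 and G2, with separation radius `h_*`: if `r_i(x) < h_*` then
`α_{i−1}(x) + α_i(x) > 2π/3`. -/
theorem small_r_large_alpha_sum {n : ℕ} [NeZero n] (P : ConvexPolygon n)
    (γstar dstar hstar : ℝ) (hd : 0 < dstar)
    (hdiam : Metric.diam P.region = 1) (hG1 : P.G1 γstar) (hG2 : P.G2 dstar)
    (hpos : 0 < hstar) (hsep : P.SepProp hstar)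
    (x : E2) (hx : x ∈ interior P.region) (i : Fin n) (hi : P.r i x < hstar) :
    2 * Real.pi / 3 < P.angleAt (i - 1) x + P.angleAt i x := by
  obtain ⟨n1, n2, n3, e4⟩ := aux_fin_ne P.hn i
  have hne : ∀ j k, j ≠ k → P.v j ≠ P.v k := fun j k hjk =>
    dist_pos.1 (hd.trans (hG2 j k hjk))
  have hv : ∀ k, P.v k ∈ P.region := fun k => subset_convexHull ℝ _ ⟨k, rfl⟩
  obtain ⟨f, f1, f2, f3⟩ := aux_support P x hx i
  obtain ⟨g, g1, g2, g3⟩ := aux_support P x hx (i - 1)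
  have L1 := aux_len P hstar hsep i
  have L2 := aux_len P hstar hsep (i - 1)
  have hi' : dist x (P.v i) < hstar := hi
  unfold ConvexPolygon.angleAt
  rw [e4] at g1 L2 ⊢
  have ind := aux_indep _ _ _ (P.extreme i) (P.extreme (i+1)) (P.extreme (i-1)) (hne _ _ n1)
    (hne _ _ n2.symm) (hne _ _ n3.symm)
  have fb := f2 _ (hv (i-1))
  have ga := g2 _ (hv (i+1))
  have nab := hne _ _ n1
  have nca := hne _ _ n2
  have nxa : x ≠ P.v i := by rintro rfl; exact lt_irrefl _ f3
  have nxb : x ≠ P.v (i + 1) := by rintro h; rw [h, f1] at f3; exact lt_irrefl _ f3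
  have nxc : x ≠ P.v (i - 1) := by rintro rfl; exact lt_irrefl _ g3
  generalize P.v i = a at *
  generalize P.v (i + 1) = b at *
  generalize P.v (i - 1) = c at *
  obtain ⟨s, t, hst⟩ := aux_cramer (x - a) _ _ ind
  have ef : f x - f a = t * (f c - f a) := by
    have := congrArg f hst
    simp only [map_sub, map_add, map_smul, smul_eq_mul] at this
    rw [this, f1]; ring
  have eg : g x - g a = s * (g b - g a) := by
    have := congrArg g hst
    simp only [map_sub, map_add, map_smul, smul_eq_mul] at this
    rw [this, g1]; ring
  have ht : 0 < t := by
    by_contra! h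
    nlinarith [mul_nonneg_of_nonpos_of_nonpos h (sub_nonpos.2 fb)]
  have hs : 0 < s := by
    by_contra! h
    nlinarith [mul_nonneg_of_nonpos_of_nonpos h (sub_nonpos.2 (g1 ▸ ga : g b ≤ g a))]
  have hsum := aux_angle_sum _ _ _ s t hs ht hst (sub_ne_zero.2 nxa) (sub_ne_zero.2 nab.symm)
    (sub_ne_zero.2 nca)
  have hsum' : ∠ b a x + ∠ x a c ≤ π := hsum
  have A1 := aux_small_angle x a b (by linarith) nxb
  have A2 := aux_small_angle x a c (by rw [dist_comm a c]; linarith) nxc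
  have T1 := EuclideanGeometry.angle_add_angle_add_angle_eq_pi (p₁ := a) (p₂ := x) b nxa
  have T2 := EuclideanGeometry.angle_add_angle_add_angle_eq_pi (p₁ := a) (p₂ := x) c nxa
  rw [angle_comm c x a] at *
  rw [angle_comm b a x] at *
  rw [angle_comm c a x] at T2
  linarith
end
end

section
/- Let a, b, x ∈ ℝ² be three points that are not collinear. Then the function y ↦ ∠ a y b (the Euclidean angle at y between a − y and b − y) is differentiable at x, and the norm of its gradient at x satisfies ‖∇(∠ a · b)(x)‖ ≤ 1/|x − a| + 1/|x − b|. -/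
open EuclideanGeometry Metric Real

noncomputable section

lemma aux_w (u v : E2) (hu : u ≠ 0) (hv : v ≠ 0) (c : ℝ) (hc : c = inner ℝ u v / (‖u‖ * ‖v‖)) :
    ‖(1 / ‖v‖) • v - (c / ‖u‖) • u‖ = √(1 - c ^ 2) := by
  have hU : ‖u‖ ≠ 0 := norm_ne_zero_iff.2 hu
  have hV : ‖v‖ ≠ 0 := norm_ne_zero_iff.2 hv
  have hp : inner ℝ u v = c * (‖u‖ * ‖v‖) := by rw [hc]; field_simp
  have h2 : ‖(1 / ‖v‖) • v - (c / ‖u‖) • u‖ ^ 2 = 1 - c ^ 2 := by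
    rw [norm_sub_sq_real, norm_smul, norm_smul, inner_smul_left, inner_smul_right,
      real_inner_comm, hp, Real.norm_eq_abs, Real.norm_eq_abs, mul_pow, mul_pow, sq_abs, sq_abs]
    simp only [conj_trivial]
    field_simp
    ring
  rw [← h2, Real.sqrt_sq (norm_nonneg _)]

lemma aux_norm (u h : E2) (hu : u ≠ 0) :
    HasDerivAt (fun t : ℝ => ‖u - t • h‖) (-(inner ℝ h u / ‖u‖)) 0 := by
  have hU : ‖u‖ ≠ 0 := norm_ne_zero_iff.2 hu
  have h1 : HasDerivAt (fun t : ℝ => u - t • h) (-h) 0 := by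
    simpa using ((hasDerivAt_id (0 : ℝ)).smul_const h).const_sub u
  have h2 := (h1.inner ℝ h1).sqrt (by simpa using hu)
  have h3 : (fun t : ℝ => ‖u - t • h‖) =
      fun t : ℝ => √(inner ℝ (u - t • h) (u - t • h)) := by
    funext t
    rw [real_inner_self_eq_norm_sq, Real.sqrt_sq (norm_nonneg _)]
  rw [h3]
  convert h2 using 1
  simp only [zero_smul, sub_zero, inner_neg_left, inner_neg_right, real_inner_self_eq_norm_sq,
    Real.sqrt_sq (norm_nonneg _), real_inner_comm h u]
  field_simp
  ring

lemma aux_deriv (u v h : E2) (hu : u ≠ 0) (hv : v ≠ 0) (c : ℝ)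
    (hc : c = inner ℝ u v / (‖u‖ * ‖v‖)) :
    HasDerivAt (fun t : ℝ => inner ℝ (u - t • h) (v - t • h) / (‖u - t • h‖ * ‖v - t • h‖))
      (-(inner ℝ h ((1 / ‖v‖) • v - (c / ‖u‖) • u) / ‖u‖
        + inner ℝ h ((1 / ‖u‖) • u - (c / ‖v‖) • v) / ‖v‖)) 0 := by
  have hU : ‖u‖ ≠ 0 := norm_ne_zero_iff.2 hu
  have hV : ‖v‖ ≠ 0 := norm_ne_zero_iff.2 hv
  have h1 : ∀ u : E2, HasDerivAt (fun t : ℝ => u - t • h) (-h) 0 := fun u => by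
    simpa using ((hasDerivAt_id (0 : ℝ)).smul_const h).const_sub u
  have hp : inner ℝ u v = c * (‖u‖ * ‖v‖) := by rw [hc]; field_simp
  have h2 := ((h1 u).inner ℝ (h1 v)).fun_div ((aux_norm u h hu).fun_mul (aux_norm v h hv))
    (by simp [hu, hv])
  refine h2.congr_deriv ?_
  simp only [zero_smul, sub_zero, inner_neg_left, inner_neg_right, inner_sub_right,
    inner_smul_right, real_inner_comm h u, hp]
  field_simp
  ring

/-- For non-collinear `a, b, x ∈ ℝ²`, the angle function `y ↦ ∠ a y b`
is differentiable at `x` and `‖∇(∠ a · b)(x)‖ ≤ 1/|x − a| + 1/|x − b|`. -/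
theorem gradient_angle_bound (a b x : E2)
    (hcol : ¬ Collinear ℝ ({a, b, x} : Set E2)) :
    DifferentiableAt ℝ (fun y : E2 => ∠ a y b) x ∧
      ‖gradient (fun y : E2 => ∠ a y b) x‖ ≤ 1 / dist x a + 1 / dist x b := by
  have hcol' : ¬ Collinear ℝ ({a, x, b} : Set E2) := by
    rwa [Set.pair_comm x b]
  have hau : a - x ≠ 0 := by
    rw [sub_ne_zero]; rintro rfl
    exact hcol' (by simpa using collinear_pair ℝ a b)
  have hbu : b - x ≠ 0 := by
    rw [sub_ne_zero]; rintro rfl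
    exact hcol' (by simpa using collinear_pair ℝ a b)
  set u := a - x with hu
  set v := b - x with hv
  have hU : 0 < ‖u‖ := norm_pos_iff.2 hau
  have hV : 0 < ‖v‖ := norm_pos_iff.2 hbu
  obtain ⟨c, hc⟩ : ∃ c : ℝ, c = inner ℝ u v / (‖u‖ * ‖v‖) := ⟨_, rfl⟩
  have hf : (fun y : E2 => ∠ a y b) =
      fun y => arccos (inner ℝ (a - y) (b - y) / (‖a - y‖ * ‖b - y‖)) := by
    funext y; rfl
  have hang : arccos c = ∠ a x b := by rw [hc]; rfl
  have hc1 : c ≠ -1 := by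
    rintro h
    exact angle_ne_pi_of_not_collinear hcol' (by rw [← hang, h, arccos_neg_one])
  have hc2 : c ≠ 1 := by
    rintro h
    exact angle_ne_zero_of_not_collinear hcol' (by rw [← hang, h, arccos_one])
  have hs : 0 < √(1 - c ^ 2) := by
    rw [← Real.sin_arccos, hang]
    exact sin_pos_of_not_collinear hcol'
  have hd : DifferentiableAt ℝ (fun y : E2 => ∠ a y b) x := by
    rw [hf]
    have hda : DifferentiableAt ℝ (fun y : E2 => a - y) x := by fun_prop
    have hdb : DifferentiableAt ℝ (fun y : E2 => b - y) x := by fun_prop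
    have hn : DifferentiableAt ℝ (fun y : E2 => ‖a - y‖ * ‖b - y‖) x :=
      (hda.norm ℝ hau).fun_mul (hdb.norm ℝ hbu)
    have hne : ‖a - x‖ * ‖b - x‖ ≠ 0 := mul_ne_zero hU.ne' hV.ne'
    have hq : DifferentiableAt ℝ
        (fun y : E2 => inner ℝ (a - y) (b - y) / (‖a - y‖ * ‖b - y‖)) x := by
      simp only [div_eq_mul_inv]
      exact (hda.inner ℝ hdb).fun_mul (hn.fun_inv hne)
    have := (Real.differentiableAt_arccos (x := c)).2 ⟨hc1, hc2⟩
    rw [hc] at this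
    exact DifferentiableAt.comp (g := arccos) x this hq
  refine ⟨hd, ?_⟩
  rw [gradient, LinearIsometryEquiv.norm_map, dist_comm x a, dist_comm x b, dist_eq_norm,
    dist_eq_norm, ← hu, ← hv]
  refine ContinuousLinearMap.opNorm_le_bound _ (by positivity) fun h => ?_
  have hline : HasDerivAt (fun t : ℝ => x + t • h) h 0 := by
    simpa using ((hasDerivAt_id (0 : ℝ)).smul_const h).const_add x
  have e1 : HasDerivAt (fun t : ℝ => ∠ a (x + t • h) b)
      (fderiv ℝ (fun y : E2 => ∠ a y b) x h) 0 := by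
    have hd' : HasFDerivAt (fun y : E2 => ∠ a y b) (fderiv ℝ (fun y : E2 => ∠ a y b) x)
      (x + (0 : ℝ) • h) := by simpa using hd.hasFDerivAt
    exact hd'.comp_hasDerivAt (0 : ℝ) hline
  have e2 := aux_deriv u v h hau hbu c hc
  have e3 := (Real.hasDerivAt_arccos hc1 hc2)
  have e3' : HasDerivAt arccos (-(1 / √(1 - c ^ 2)))
      (inner ℝ (u - (0 : ℝ) • h) (v - (0 : ℝ) • h) /
        (‖u - (0 : ℝ) • h‖ * ‖v - (0 : ℝ) • h‖)) := by
    simpa [← hc] using e3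
  have e4 := e3'.comp (0 : ℝ) e2
  have e5 : (fun t : ℝ => ∠ a (x + t • h) b) = arccos ∘ (fun t : ℝ =>
      inner ℝ (u - t • h) (v - t • h) / (‖u - t • h‖ * ‖v - t • h‖)) := by
    funext t
    simp only [hu, hv, sub_sub]
    rfl
  rw [e5] at e1
  rw [e1.unique e4]
  have b1 := abs_real_inner_le_norm h ((1 / ‖v‖) • v - (c / ‖u‖) • u)
  have b2 := abs_real_inner_le_norm h ((1 / ‖u‖) • u - (c / ‖v‖) • v)
  rw [aux_w u v hau hbu c hc] at b1
  rw [aux_w v u hbu hau c (by rw [hc, real_inner_comm, mul_comm])] at b2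
  generalize inner ℝ h ((1 / ‖v‖) • v - (c / ‖u‖) • u) = p at *
  generalize inner ℝ h ((1 / ‖u‖) • u - (c / ‖v‖) • v) = q at *
  rw [neg_mul_neg, Real.norm_eq_abs, abs_mul, abs_of_pos (by positivity : 0 < 1 / √(1 - c ^ 2))]
  calc 1 / √(1 - c ^ 2) * |p / ‖u‖ + q / ‖v‖|
      ≤ 1 / √(1 - c ^ 2) * (‖h‖ * √(1 - c ^ 2) / ‖u‖ + ‖h‖ * √(1 - c ^ 2) / ‖v‖) := by
        refine mul_le_mul_of_nonneg_left ?_ (by positivity)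
        refine (abs_add_le _ _).trans ?_
        rw [abs_div, abs_div, abs_of_pos hU, abs_of_pos hV]
        gcongr
    _ = (1 / ‖u‖ + 1 / ‖v‖) * ‖h‖ := by
        field_simp
end
end

section
/- Let Ω be a convex polygon of diameter at most 1 with vertices v_1, …, v_n. Then for every x in the interior of Ω, Σ_{i=1}^n w_i(x) ≥ 2π, where w_i(x) := (t_{i−1}(x) + t_i(x))/r_i(x). -/
open EuclideanGeometry Metric Real

noncomputable section

lemma exists_polar (p : E2) : ∃ R A : ℝ, 0 ≤ R ∧ p 0 = R * cos A ∧ p 1 = R * sin A ∧ ‖p‖ = R := by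
  refine ⟨‖(⟨p 0, p 1⟩ : ℂ)‖, Complex.arg ⟨p 0, p 1⟩, norm_nonneg _, ?_, ?_, ?_⟩
  · rw [Complex.norm_mul_cos_arg]
  · rw [Complex.norm_mul_sin_arg]
  · rw [EuclideanSpace.norm_eq, Complex.norm_def, Complex.normSq_apply, Fin.sum_univ_two]
    simp [sq]

lemma cone_key (p q : E2) (hp : p ≠ 0) (hq : q ≠ 0) :
    ∃ φ : ℝ, ∀ θ t a b : ℝ, 0 < t → 0 ≤ a → 0 ≤ b →
      t * cos θ = a * p 0 + b * q 0 → t * sin θ = a * p 1 + b * q 1 →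
      cos (InnerProductGeometry.angle p q / 2) ≤ cos (θ - φ) := by
  obtain ⟨R, A, hR, hp0, hp1, hpn⟩ := exists_polar p
  obtain ⟨S, B', hS, hq0, hq1, hqn⟩ := exists_polar q
  have hR' : 0 < R := hpn ▸ norm_pos_iff.mpr hp
  have hS' : 0 < S := hqn ▸ norm_pos_iff.mpr hq
  obtain ⟨d, hd, hdc, hds⟩ : ∃ d : ℝ, |d| ≤ π ∧ cos (A + d) = cos B' ∧ sin (A + d) = sin B' := by
    refine ⟨((B' - A : ℝ) : Real.Angle).toReal, Real.Angle.abs_toReal_le_pi _, ?_, ?_⟩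
    · rw [← Real.Angle.cos_coe, Real.Angle.coe_add, Real.Angle.coe_toReal, ← Real.Angle.coe_add,
        Real.Angle.cos_coe]; congr 1; ring
    · rw [← Real.Angle.sin_coe, Real.Angle.coe_add, Real.Angle.coe_toReal, ← Real.Angle.coe_add,
        Real.Angle.sin_coe]; congr 1; ring
  rw [← hdc] at hq0
  rw [← hds] at hq1
  have hang : InnerProductGeometry.angle p q = |d| := by
    unfold InnerProductGeometry.angle
    have hi : inner ℝ p q = R * S * cos d := by
      have : cos d = cos (A + d) * cos A + sin (A + d) * sin A := by
        rw [← cos_sub]; congr 1; ring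
      rw [this, PiLp.inner_apply, Fin.sum_univ_two]
      simp only [hp0, hp1, hq0, hq1, RCLike.inner_apply, conj_trivial]
      ring
    rw [hi, hpn, hqn, mul_div_cancel_left₀ _ (by positivity), ← cos_abs d]
    exact arccos_cos (abs_nonneg _) hd
  have hc2 : cos (|d| / 2) = cos (d / 2) := by
    rcases abs_choice d with h | h <;> rw [h]
    rw [neg_div, cos_neg]
  have hc0 : 0 ≤ cos (d / 2) := by
    rw [← hc2]
    exact cos_nonneg_of_mem_Icc ⟨by linarith [abs_nonneg d, pi_pos], by linarith⟩
  refine ⟨A + d / 2, fun θ t a b ht ha hb h0 h1 => ?_⟩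
  rw [hang, hc2]
  rw [hp0, hq0] at h0
  rw [hp1, hq1] at h1
  have e1 : t * cos (θ - (A + d / 2)) = (a * R + b * S) * cos (d / 2) := by
    have x1 : cos (d/2) = cos A * cos (A + d/2) + sin A * sin (A + d/2) := by
      rw [← cos_sub, ← cos_neg]; congr 1; ring
    have x2 : cos (d/2) = cos (A + d) * cos (A + d/2) + sin (A + d) * sin (A + d/2) := by
      rw [← cos_sub]; congr 1; ring
    rw [cos_sub]
    linear_combination cos (A + d/2) * h0 + sin (A + d/2) * h1 - a * R * x1 - b * S * x2
  have e2 : t = a * R * cos (θ - A) + b * S * cos (θ - (A + d)) := by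
    rw [cos_sub, cos_sub]
    linear_combination cos θ * h0 + sin θ * h1 - t * sin_sq_add_cos_sq θ
  have e3 : t ≤ a * R + b * S := by
    have := mul_le_mul_of_nonneg_left (cos_le_one (θ - A)) (mul_nonneg ha hR)
    have := mul_le_mul_of_nonneg_left (cos_le_one (θ - (A + d))) (mul_nonneg hb hS)
    linarith
  have := mul_le_mul_of_nonneg_right e3 hc0
  rw [← e1] at this
  exact le_of_mul_le_mul_left this ht

lemma norm_angle_le (z α : ℝ) (h0 : 0 ≤ α) (h1 : α ≤ π) (h : cos α ≤ cos z) :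
    ‖(z : AddCircle (2 * π))‖ ≤ α := by
  have hz : (z : AddCircle (2 * π)) = (((z : Real.Angle).toReal : ℝ) : AddCircle (2 * π)) :=
    (Real.Angle.coe_toReal (z : Real.Angle)).symm
  have hc : cos z = cos |(z : Real.Angle).toReal| := by
    rw [cos_abs, Real.Angle.cos_toReal, Real.Angle.cos_coe]
  rw [hc] at h
  have : |(z : Real.Angle).toReal| ≤ α := by
    by_contra! hlt
    exact absurd h (not_le.mpr (cos_lt_cos_of_nonneg_of_le_pi h0 (Real.Angle.abs_toReal_le_pi _) hlt))
  rw [hz]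
  refine le_trans ?_ this
  rw [← Real.norm_eq_abs]
  exact QuotientAddGroup.norm_mk_le_norm

lemma ray_hits {K : Set E2} (hK : Bornology.IsBounded K) {x u : E2} (hx : x ∈ interior K)
    (hu : ‖u‖ = 1) : ∃ t : ℝ, 0 < t ∧ x + t • u ∈ frontier K := by
  have hpre : IsPreconnected ((fun t : ℝ => x + t • u) '' Set.Ici 0) :=
    isPreconnected_Ici.image _ (by fun_prop)
  obtain ⟨M, hM⟩ := hK.subset_closedBall x
  have hM0 : 0 ≤ M := by
    have := hM (interior_subset hx)
    simpa using this
  have hne : ((fun t : ℝ => x + t • u) '' Set.Ici 0 ∩ frontier K).Nonempty := by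
    by_contra hcon
    have h2 := hpre.subset_or_subset (isOpen_interior (s := K)) (isClosed_closure (s := K)).isOpen_compl
      (Set.disjoint_left.mpr fun y hy hy' => hy' (subset_closure (interior_subset hy)))
      (fun y hy => by
        by_contra hn
        simp only [Set.mem_union, not_or, Set.mem_compl_iff, not_not] at hn
        exact hcon ⟨y, hy, hn.2, hn.1⟩)
    rcases h2 with h | h
    · have h3 := hM (interior_subset (h ⟨M + 1, by simp; linarith, rfl⟩))
      simp only [mem_closedBall, dist_self_add_left, norm_smul, hu, Real.norm_eq_abs, mul_one] at h3
      rw [abs_of_nonneg (by linarith)] at h3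
      linarith
    · exact h ⟨0, by simp, by simp⟩ (subset_closure (interior_subset hx))
  obtain ⟨y, ⟨t, ht, rfl⟩, hy⟩ := hne
  refine ⟨t, lt_of_le_of_ne ht ?_, hy⟩
  rintro rfl
  simp only [zero_smul, add_zero] at hy
  exact hy.2 hx

open ConvexPolygon in
lemma polygon_bounded {n : ℕ} [NeZero n] (P : ConvexPolygon n) : Bornology.IsBounded P.region :=
  (isBounded_convexHull).mpr (Set.finite_range P.v).isBounded

open ConvexPolygon in
lemma not_mem_edge {n : ℕ} [NeZero n] (P : ConvexPolygon n)
    (x : E2) (hx : x ∈ interior P.region) (i : Fin n) : x ∉ segment ℝ (P.v i) (P.v (i + 1)) := by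
  intro h
  have : x ∈ frontier P.region := by
    unfold ConvexPolygon.region
    rw [P.boundary]
    exact Set.mem_iUnion.mpr ⟨i, h⟩
  exact this.2 hx

open ConvexPolygon in
lemma sum_angles {n : ℕ} [NeZero n] (P : ConvexPolygon n)
    (x : E2) (hx : x ∈ interior P.region) : 2 * π ≤ ∑ i, P.angleAt i x := by
  have hne : ∀ i, P.v i - x ≠ 0 := fun i h => by
    rw [sub_eq_zero] at h
    exact not_mem_edge P x hx i (h ▸ left_mem_segment ℝ _ _)
  choose φ hφ using fun i => cone_key (P.v i - x) (P.v (i + 1) - x) (hne i) (hne (i + 1))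
  have hang : ∀ i, P.angleAt i x = InnerProductGeometry.angle (P.v i - x) (P.v (i + 1) - x) :=
    fun i => rfl
  have hnn : ∀ i, 0 ≤ P.angleAt i x := fun i => by
    rw [hang]; exact InnerProductGeometry.angle_nonneg _ _
  haveI : Fact (0 < 2 * π) := ⟨by positivity⟩
  have hcov : (Set.univ : Set (AddCircle (2 * π))) ⊆
      ⋃ i ∈ (Finset.univ : Finset (Fin n)),
        closedBall ((φ i : ℝ) : AddCircle (2 * π)) (P.angleAt i x / 2) := by
    intro z _
    obtain ⟨θ, rfl⟩ := QuotientAddGroup.mk_surjective z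
    obtain ⟨t, ht, hf⟩ := ray_hits (polygon_bounded P) hx (u := !₂[cos θ, sin θ]) (by
      rw [EuclideanSpace.norm_eq, Fin.sum_univ_two]; simp)
    unfold ConvexPolygon.region at hf
    rw [P.boundary] at hf
    obtain ⟨i, a, b, ha, hb, hab, he⟩ := Set.mem_iUnion.mp hf
    refine Set.mem_iUnion₂.mpr ⟨i, Finset.mem_univ _, ?_⟩
    have hb' : b = 1 - a := by linarith
    have e0 := congrArg (fun y : E2 => y 0) he
    have e1 := congrArg (fun y : E2 => y 1) he
    simp at e0 e1
    have key := hφ i θ t a b ht ha hb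
      (by simp; subst hb'; linear_combination -e0) (by simp; subst hb'; linear_combination -e1)
    rw [← hang] at key
    have hpi : P.angleAt i x ≤ π := InnerProductGeometry.angle_le_pi _ _
    have := norm_angle_le (θ - φ i) (P.angleAt i x / 2) (by linarith [hnn i])
      (by linarith [pi_pos]) key
    rw [mem_closedBall, dist_eq_norm]
    exact this
  have h1 := (MeasureTheory.measure_mono hcov (μ := MeasureTheory.volume)).trans
    (MeasureTheory.measure_biUnion_finset_le _ _)
  rw [AddCircle.measure_univ] at h1
  have h2 := h1.trans (Finset.sum_le_sum (g := fun i => ENNReal.ofReal (P.angleAt i x))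
    fun i _ => by
      rw [AddCircle.volume_closedBall]
      exact ENNReal.ofReal_le_ofReal ((min_le_right _ _).trans (by linarith)))
  rw [← ENNReal.ofReal_sum_of_nonneg (fun i _ => hnn i)] at h2
  exact (ENNReal.ofReal_le_ofReal_iff (Finset.sum_nonneg fun i _ => hnn i)).mp h2

open ConvexPolygon in
/-- for a convex polygon of diameter at most 1 and `x` in its interior,
`Σ_i w_i(x) ≥ 2π`. -/
theorem sum_weights_ge_two_pi {n : ℕ} [NeZero n] (P : ConvexPolygon n)
    (hdiam : Metric.diam P.region ≤ 1)
    (x : E2) (hx : x ∈ interior P.region) :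
    2 * Real.pi ≤ ∑ i : Fin n, P.w i x := by
  refine (sum_angles P x hx).trans ?_
  have ht : ∀ i, P.angleAt i x / 2 ≤ P.t i x := fun i => by
    have h0 : 0 ≤ P.angleAt i x := InnerProductGeometry.angle_nonneg _ _
    have hpi : P.angleAt i x ≤ π := InnerProductGeometry.angle_le_pi _ _
    have hlt : P.angleAt i x < π := lt_of_le_of_ne hpi fun h => by
      have := (EuclideanGeometry.angle_eq_pi_iff_sbtw.mp h).wbtw.mem_segment
      exact not_mem_edge P x hx i this
    exact Real.le_tan (by linarith) (by linarith)
  have ht0 : ∀ i, 0 ≤ P.t i x := fun i => by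
    have h0 : 0 ≤ P.angleAt i x := InnerProductGeometry.angle_nonneg _ _
    linarith [ht i]
  have hw : ∀ i, P.t (i - 1) x + P.t i x ≤ P.w i x := fun i => by
    have hr : 0 < P.r i x := dist_pos.mpr fun h =>
      not_mem_edge P x hx i (h ▸ left_mem_segment ℝ _ _)
    have hr1 : P.r i x ≤ 1 := (Metric.dist_le_diam_of_mem (polygon_bounded P)
      (interior_subset hx) (subset_convexHull ℝ _ ⟨i, rfl⟩)).trans hdiam
    unfold ConvexPolygon.w
    rw [le_div_iff₀ hr]
    exact mul_le_of_le_one_right (add_nonneg (ht0 _) (ht0 _)) hr1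
  calc ∑ i, P.angleAt i x ≤ ∑ i, (P.t i x + P.t i x) :=
        Finset.sum_le_sum fun i _ => by linarith [ht i]
    _ = ∑ i, (P.t (i - 1) x + P.t i x) := by
        rw [Finset.sum_add_distrib, Finset.sum_add_distrib]
        congr 1
        exact (Equiv.sum_comp (Equiv.subRight (1 : Fin n)) fun i => P.t i x).symm
    _ ≤ _ := Finset.sum_le_sum fun i _ => hw i
end
end
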